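/- Consider the action of GL₂(ℚ) on ℚ ∪ {∞} by fractional linear transformations: a matrix [[a, b], [c, d]] sends t to (a·t + b)/(c·t + d), with the conventions that ∞ is sent to a/c and that t is sent to ∞ when c·t + d = 0 (and ∞ ↦ ∞ when c = 0). Let α = [[1/2, −4], [1/4, 0]] and β = [[1/2, −1/4], [4, 0]], let X be the set of rational numbers that can be written as a fraction p/q with p, q integers and q odd, and let Y = (ℚ ∪ {∞}) \ X. Then for every nonzero integer n, αⁿ maps Y into X and βⁿ maps X into Y. -/

import Mathlib

open scoped OnePoint

/-- The fractional linear transformation of ℚ ∪ {∞} associated to a 2 × 2 rational matrix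
[[a, b], [c, d]]: it sends t to (a·t + b)/(c·t + d), sends ∞ to a/c (and to ∞ when c = 0),
and sends t to ∞ when c·t + d = 0. -/
def mobius (g : Matrix (Fin 2) (Fin 2) ℚ) : OnePoint ℚ → OnePoint ℚ := fun t =>
  match t with
  | none => if g 1 0 = 0 then ∞ else ((g 0 0 / g 1 0 : ℚ) : OnePoint ℚ)
  | some x =>
      if g 1 0 * x + g 1 1 = 0 then ∞
      else ((g 0 0 * x + g 0 1) / (g 1 0 * x + g 1 1) : ℚ)

/-- The matrix α = [[1/2, −4], [1/4, 0]], as an element of SL₂(ℚ). -/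
def alphaSL : Matrix.SpecialLinearGroup (Fin 2) ℚ :=
  ⟨!![(1/2 : ℚ), -4; 1/4, 0], by norm_num [Matrix.det_fin_two_of]⟩

/-- The matrix β = [[1/2, −1/4], [4, 0]], as an element of SL₂(ℚ). -/
def betaSL : Matrix.SpecialLinearGroup (Fin 2) ℚ :=
  ⟨!![(1/2 : ℚ), -1/4; 4, 0], by norm_num [Matrix.det_fin_two_of]⟩

/-- X: the points of ℚ ∪ {∞} given by rationals representable as p/q with q an odd integer. -/
def oddDenomSet : Set (OnePoint ℚ) :=
  {t | ∃ p q : ℤ, Odd q ∧ t = ((p / q : ℚ) : OnePoint ℚ)}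

/-- Fractional linear transformations are insensitive to rescaling the matrix. -/
lemma mobius_smul {c : ℚ} (hc : c ≠ 0) (g : Matrix (Fin 2) (Fin 2) ℚ) :
    mobius (c • g) = mobius g := by
  funext t
  cases t with
  | infty => simp [mobius, hc, mul_div_mul_left]
  | coe x =>
    simp only [mobius, Matrix.smul_apply, smul_eq_mul, mul_assoc, ← mul_add, mul_eq_zero, hc,
      false_or, mul_div_mul_left _ _ hc]

lemma coe_mem_oddDenomSet {x : ℚ} (hx : Odd x.den) : (x : OnePoint ℚ) ∈ oddDenomSet :=
  ⟨x.num, x.den, by exact_mod_cast hx, by rw [Int.cast_natCast, Rat.num_div_den]⟩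

lemma infty_notMem_oddDenomSet : ∞ ∉ oddDenomSet := by
  rintro ⟨p, q, -, h⟩
  exact OnePoint.infty_ne_coe _ h

lemma div_notMem_oddDenomSet {p q : ℤ} (hp : Odd p) (hq : Even q) (hq0 : q ≠ 0) :
    ((p / q : ℚ) : OnePoint ℚ) ∉ oddDenomSet := by
  rintro ⟨r, s, hs, h⟩
  have hs0 : (s : ℚ) ≠ 0 := by
    rintro h0
    simp [Int.cast_eq_zero.1 h0] at hs
  have h' := OnePoint.coe_injective h
  rw [div_eq_div_iff (by exact_mod_cast hq0) hs0] at h'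
  have hps : p * s = r * q := by exact_mod_cast h'
  exact Int.not_even_iff_odd.2 (hp.mul hs) (hps ▸ hq.mul_left r)

/-- An integer matrix with odd lower-left entry maps the complement of `oddDenomSet` into it. -/
lemma mapsTo_mobius_compl_oddDenomSet {a b c d : ℤ} (hc : Odd c) :
    Set.MapsTo (mobius !![(a : ℚ), b; c, d]) oddDenomSetᶜ oddDenomSet := by
  have hc0 : c ≠ 0 := by rintro rfl; simp at hc
  intro t ht
  cases t with
  | infty => exact ⟨a, c, hc, by simp [mobius, hc0]⟩
  | coe x =>
    have hden : Even (x.den : ℤ) := by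
      have : Even x.den := Nat.not_odd_iff_even.1 fun h => ht (coe_mem_oddDenomSet h)
      exact_mod_cast this
    have hnum : Odd x.num := by
      rw [← Int.not_even_iff_odd]
      intro h
      exact absurd (x.isCoprime_num_den.isUnit_of_dvd' h.two_dvd hden.two_dvd) (by decide)
    have hodd : Odd (c * x.num + d * x.den) := (hc.mul hnum).add_even (hden.mul_left d)
    have hx0 : (x.den : ℚ) ≠ 0 := by exact_mod_cast x.den_nz
    have hx : x * x.den = x.num := Rat.mul_den_eq_num x
    have hne : (c : ℚ) * x + d ≠ 0 := by
      intro h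
      have : c * x.num + d * x.den = 0 := by
        have : (c : ℚ) * x.num + d * x.den = 0 := by
          rw [← hx]; linear_combination (x.den : ℚ) * h
        exact_mod_cast this
      simp [this] at hodd
    refine ⟨a * x.num + b * x.den, c * x.num + d * x.den, hodd, ?_⟩
    have hval : ((a : ℚ) * x + b) / (c * x + d)
        = ((a * x.num + b * x.den : ℤ) : ℚ) / (c * x.num + d * x.den : ℤ) := by
      push_cast
      rw [← hx, ← mul_div_mul_right _ _ hx0]
      ring_nf
    simp [mobius, hne, hval]

/-- An integer matrix whose entries are even except for an odd upper-right entry maps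
`oddDenomSet` into its complement. -/
lemma mapsTo_mobius_oddDenomSet_compl {a b c d : ℤ} (ha : Even a) (hb : Odd b) (hc : Even c)
    (hd : Even d) :
    Set.MapsTo (mobius !![(a : ℚ), b; c, d]) oddDenomSet oddDenomSetᶜ := by
  rintro t ⟨p, q, hq, rfl⟩
  have hq0 : (q : ℚ) ≠ 0 := by
    rintro h0
    simp [Int.cast_eq_zero.1 h0] at hq
  by_cases h : (c : ℚ) * (p / q) + d = 0
  · simpa [mobius, h] using infty_notMem_oddDenomSet
  · have hne : c * p + d * q ≠ 0 := by
      intro h'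
      apply h
      have : (c : ℚ) * p + d * q = 0 := by exact_mod_cast h'
      field_simp
      linear_combination this
    have hval : ((a : ℚ) * (p / q) + b) / (c * (p / q) + d)
        = ((a * p + b * q : ℤ) : ℚ) / (c * p + d * q : ℤ) := by
      push_cast
      rw [← mul_div_mul_right _ _ hq0]
      congr 1 <;> field_simp
    have := div_notMem_oddDenomSet ((ha.mul_right p).add_odd (hb.mul hq))
      ((hc.mul_right p).add (hd.mul_right q)) hne
    simpa only [mobius, Matrix.of_apply, Matrix.cons_val', Matrix.cons_val_zero,
      Matrix.cons_val_one, Matrix.cons_val_fin_one, h, if_false, hval, Set.mem_compl_iff] using this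

lemma alphaSL_pow_succ (n : ℕ) : ∃ a b : ℤ, Odd a ∧
    ((alphaSL ^ (n + 1) : Matrix.SpecialLinearGroup (Fin 2) ℚ) : Matrix (Fin 2) (Fin 2) ℚ) =
      ((2 : ℚ) ^ (n + 2))⁻¹ • !![2 * (a - 4 * b : ℚ), -16 * a; (a : ℚ), -8 * b] := by
  induction n with
  | zero =>
    refine ⟨1, 0, odd_one, ?_⟩
    rw [zero_add, pow_one]
    ext i j
    fin_cases i <;> fin_cases j <;> norm_num [alphaSL]
  | succ n ih =>
    obtain ⟨a, b, ha, h⟩ := ih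
    refine ⟨a - 4 * b, a, ha.sub_even (by grind), ?_⟩
    rw [pow_succ, Matrix.SpecialLinearGroup.coe_mul, h, pow_succ _ (n + 2)]
    ext i j
    fin_cases i <;> fin_cases j <;> simp [alphaSL, Matrix.mul_apply, Fin.sum_univ_two] <;> ring

lemma betaSL_pow_succ (n : ℕ) : ∃ a b : ℤ, Odd a ∧
    ((betaSL ^ (n + 1) : Matrix.SpecialLinearGroup (Fin 2) ℚ) : Matrix (Fin 2) (Fin 2) ℚ) =
      ((2 : ℚ) ^ (n + 2))⁻¹ • !![2 * (a - 4 * b : ℚ), -a; 16 * (a : ℚ), -8 * b] := by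
  induction n with
  | zero =>
    refine ⟨1, 0, odd_one, ?_⟩
    rw [zero_add, pow_one]
    ext i j
    fin_cases i <;> fin_cases j <;> norm_num [betaSL]
  | succ n ih =>
    obtain ⟨a, b, ha, h⟩ := ih
    refine ⟨a - 4 * b, a, ha.sub_even (by grind), ?_⟩
    rw [pow_succ, Matrix.SpecialLinearGroup.coe_mul, h, pow_succ _ (n + 2)]
    ext i j
    fin_cases i <;> fin_cases j <;> simp [betaSL, Matrix.mul_apply, Fin.sum_univ_two] <;> ring

/-- with X the set of rationals with an odd-denominator representation and
Y = (ℚ ∪ {∞}) \ X, for every nonzero integer n the fractional linear transformation of αⁿ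
maps Y into X and that of βⁿ maps X into Y. -/
theorem ping_pong_alpha_beta :
    ∀ n : ℤ, n ≠ 0 →
      Set.MapsTo (mobius ((alphaSL ^ n : Matrix.SpecialLinearGroup (Fin 2) ℚ) :
          Matrix (Fin 2) (Fin 2) ℚ)) oddDenomSetᶜ oddDenomSet ∧
      Set.MapsTo (mobius ((betaSL ^ n : Matrix.SpecialLinearGroup (Fin 2) ℚ) :
          Matrix (Fin 2) (Fin 2) ℚ)) oddDenomSet oddDenomSetᶜ := by
  intro n hn
  obtain ⟨m, hm⟩ : ∃ m : ℕ, n.natAbs = m + 1 := Nat.exists_eq_succ_of_ne_zero (by simpa using hn)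
  obtain ⟨a, b, ha, hα⟩ := alphaSL_pow_succ m
  obtain ⟨r, s, hr, hβ⟩ := betaSL_pow_succ m
  have hc : ((2 : ℚ) ^ (m + 2))⁻¹ ≠ 0 := by positivity
  rcases Int.natAbs_eq n with h | h <;> rw [h, hm]
  · rw [zpow_natCast, zpow_natCast, hα, hβ, mobius_smul hc, mobius_smul hc]
    constructor
    · exact_mod_cast mapsTo_mobius_compl_oddDenomSet (a := 2 * (a - 4 * b)) (b := -16 * a)
        (d := -8 * b) ha
    · exact_mod_cast mapsTo_mobius_oddDenomSet_compl (a := 2 * (r - 4 * s)) (b := -r)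
        (c := 16 * r) (d := -8 * s) (by simp) hr.neg (by grind)
        (by grind)
  · rw [zpow_neg, zpow_neg, zpow_natCast, zpow_natCast, Matrix.SpecialLinearGroup.coe_inv,
      Matrix.SpecialLinearGroup.coe_inv, hα, hβ, Matrix.adjugate_smul, Matrix.adjugate_smul,
      Matrix.adjugate_fin_two_of, Matrix.adjugate_fin_two_of, mobius_smul (pow_ne_zero _ hc),
      mobius_smul (pow_ne_zero _ hc)]
    constructor
    · exact_mod_cast mapsTo_mobius_compl_oddDenomSet (a := -8 * b) (b := -(-16 * a))
        (d := 2 * (a - 4 * b)) ha.neg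
    · exact_mod_cast mapsTo_mobius_oddDenomSet_compl (a := -8 * s) (b := -(-r))
        (c := -(16 * r)) (d := 2 * (r - 4 * s)) (by grind) hr.neg.neg
        (by grind) (by simp)
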